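/- For a total PC(ID) theory (F,Π) and a set M of literals over the atoms At(F∪Π), the following conditions are equivalent: (a) M is a model of the PC(ID) theory (F,Π); (b) M is a model of the SM(ASP) theory [F,Π]; (c) M is a model of the SM(ASP) theory [Comp(Π_{At(Π)}) ∪ F, Π]. -/

import Mathlib

set_option maxHeartbeats 1000000

attribute [local instance] Classical.propDecidable

/-! ## Atoms, literals, clauses -/

/-- Propositional atoms. -/
abbrev Atom : Type := ℕ

/-- Propositional literals: an atom or its negation. -/
inductive Lit where
  | pos : Atom → Lit
  | neg : Atom → Lit
deriving DecidableEq

/-- The atom of a literal. -/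
def Lit.atom : Lit → Atom
  | .pos a => a
  | .neg a => a

/-- The complement (dual) of a literal. -/
def Lit.compl : Lit → Lit
  | .pos a => .neg a
  | .neg a => .pos a

/-- A clause is a set of literals (read disjunctively). -/
abbrev Clause := Set Lit

/-- A CNF formula is a set of clauses. -/
abbrev CNF := Set Clause

/-- Truth of a literal in an interpretation given as the set of true atoms. -/
def litTrue (X : Set Atom) : Lit → Prop
  | .pos a => a ∈ X
  | .neg a => a ∉ X

/-- Truth of a CNF formula in an interpretation. -/
def cnfTrue (X : Set Atom) (F : CNF) : Prop := ∀ C ∈ F, ∃ l ∈ C, litTrue X l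

/-- A CNF formula is satisfiable if some interpretation makes it true. -/
def cnfSatisfiable (F : CNF) : Prop := ∃ X : Set Atom, cnfTrue X F

/-- A set `M` of literals is a model of a CNF formula if every clause contains a literal of `M`. -/
def modelCNF (M : Set Lit) (F : CNF) : Prop := ∀ C ∈ F, ∃ l ∈ C, l ∈ M

/-- A set of literals is consistent if it contains no atom together with its negation. -/
def consistentS (M : Set Lit) : Prop := ∀ a : Atom, ¬ (Lit.pos a ∈ M ∧ Lit.neg a ∈ M)

/-- `M` is complete over a set `A` of atoms: every atom of `A` occurs (possibly negated)
in `M` and no other atoms occur in `M`. -/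
def completeOver (M : Set Lit) (A : Set Atom) : Prop :=
  (∀ a ∈ A, Lit.pos a ∈ M ∨ Lit.neg a ∈ M) ∧ ∀ l ∈ M, l.atom ∈ A

/-- `M⁺`: the atoms occurring non-negated in `M`. -/
def posPart (M : Set Lit) : Set Atom := {a | Lit.pos a ∈ M}

/-- `M^A`: the literals of `M` whose atoms lie in `A`. -/
def restrictLits (M : Set Lit) (A : Set Atom) : Set Lit := {l ∈ M | l.atom ∈ A}

/-- The set of complements of the literals of `M`. -/
def compls (M : Set Lit) : Set Lit := Lit.compl '' M

/-- The atoms occurring in a CNF formula. -/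
def atomsCNF (F : CNF) : Set Atom := ⋃ C ∈ F, Lit.atom '' C

/-- A well-formed CNF formula: a finite set of finite non-empty clauses. -/
def IsCNF (F : CNF) : Prop := F.Finite ∧ ∀ C ∈ F, C.Finite ∧ C.Nonempty

/-! ## Logic programs -/

/-- A rule `a₀ ← a₁,…,a_l, not a_{l+1},…,not a_m, not not a_{m+1},…,not not a_n`.
`head = none` encodes the empty head `⊥` (a constraint). -/
structure Rule where
  head : Option Atom
  bpos : Set Atom
  bneg : Set Atom
  bnneg : Set Atom

/-- The atoms occurring in the body of a rule. -/
def Rule.bodyAtoms (r : Rule) : Set Atom := r.bpos ∪ r.bneg ∪ r.bnneg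

/-- The atoms occurring in a rule. -/
def Rule.atoms (r : Rule) : Set Atom :=
  (match r.head with | some a => ({a} : Set Atom) | none => (∅ : Set Atom)) ∪ r.bodyAtoms

/-- `s(B)` for the body of a rule: `{a₁,…,a_l, ¬a_{l+1},…,¬a_m, a_{m+1},…,a_n}`. -/
def Rule.sBody (r : Rule) : Set Lit :=
  Lit.pos '' r.bpos ∪ Lit.neg '' r.bneg ∪ Lit.pos '' r.bnneg

/-- A (propositional) logic program, as a set of rules. -/
abbrev Program := Set Rule

/-- `Head(Π)`: the set of nonempty heads of rules of `Π`. -/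
def headSet (P : Program) : Set Atom := {a | ∃ r ∈ P, r.head = some a}

/-- `At(Π)`: the set of atoms occurring in `Π`. -/
def atomsProg (P : Program) : Set Atom := ⋃ r ∈ P, r.atoms

/-- A well-formed logic program: finitely many rules, finite bodies, and
constraints have non-empty bodies. -/
def IsProgram (P : Program) : Prop :=
  P.Finite ∧ (∀ r ∈ P, r.bpos.Finite ∧ r.bneg.Finite ∧ r.bnneg.Finite) ∧
    ∀ r ∈ P, r.head = none → r.bodyAtoms.Nonempty

/-- Rule bodies, as triples (positive part, negated part, doubly negated part). -/
abbrev BodyT := Set Atom × Set Atom × Set Atom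

/-- The body of a rule. -/
def Rule.body (r : Rule) : BodyT := (r.bpos, r.bneg, r.bnneg)

/-- `s(B)` for a body triple. -/
def sBodyB (B : BodyT) : Set Lit := Lit.pos '' B.1 ∪ Lit.neg '' B.2.1 ∪ Lit.pos '' B.2.2

/-- `Bodies(Π,a)`: the set of bodies of rules of `Π` with head `a`. -/
def bodiesOf (P : Program) (a : Atom) : Set BodyT := {B | ∃ r ∈ P, r.head = some a ∧ r.body = B}

/-! ## Answer sets -/

/-- A rule survives the reduct with respect to `X`: no `not a` with `a ∈ X`
and no `not not a` with `a ∉ X` occurs in its body. -/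
def reductKeeps (r : Rule) (X : Set Atom) : Prop :=
  (∀ a ∈ r.bneg, a ∉ X) ∧ ∀ a ∈ r.bnneg, a ∈ X

/-- `Y` is closed under the positive (non-constraint) rules of the reduct of `P` w.r.t. `X`. -/
def closedUnder (P : Program) (X Y : Set Atom) : Prop :=
  ∀ r ∈ P, reductKeeps r X → r.bpos ⊆ Y → ∀ a, r.head = some a → a ∈ Y

/-- `X` is an answer set of `P`: `X` is the least model of the positive part of the
reduct `P^X`, and no constraint of the reduct has its body contained in `X`. -/
def isAnswerSet (P : Program) (X : Set Atom) : Prop :=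
  X = ⋂₀ {Y | closedUnder P X Y} ∧
    ∀ r ∈ P, r.head = none → reductKeeps r X → ¬ r.bpos ⊆ X

/-- The fact `a ←`. -/
def factRule (a : Atom) : Rule := ⟨some a, ∅, ∅, ∅⟩

/-- The choice rule `a ← not not a`. -/
def choiceRule (a : Atom) : Rule := ⟨some a, ∅, ∅, {a}⟩

/-- `X` is an input answer set of `P`: `X` is an answer set of `P ∪ (X \ Head(P))`. -/
def inputAnswerSet (P : Program) (X : Set Atom) : Prop :=
  isAnswerSet (P ∪ factRule '' (X \ headSet P)) X

/-- `Π_A`: `Π` extended with the rule `a ← not not a` for each `a ∈ A \ Head(Π)`. -/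
def progExt (P : Program) (A : Set Atom) : Program := P ∪ choiceRule '' (A \ headSet P)

/-- `At(F ∪ Π)`: the atoms occurring in `F` and `Π`. -/
def atomsTh (F : CNF) (P : Program) : Set Atom := atomsCNF F ∪ atomsProg P

/-- `Π^o = Π_{At(F∪Π)}` for the pair `[F,Π]`. -/
def progO (F : CNF) (P : Program) : Program := progExt P (atomsTh F P)

/-- A model of the SM(ASP) theory `[F,Π]`: a consistent set of literals complete over
`At(F∪Π)` that is a model of `F` and whose positive part is an input answer set of `Π`. -/
def smModel (F : CNF) (P : Program) (M : Set Lit) : Prop :=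
  consistentS M ∧ completeOver M (atomsTh F P) ∧ modelCNF M F ∧ inputAnswerSet P (posPart M)

/-! ## Unfounded sets and the well-founded operator -/

/-- `U` is unfounded on `M` with respect to `P`. -/
def unfoundedOn (U : Set Atom) (M : Set Lit) (P : Program) : Prop :=
  U ⊆ atomsProg P ∧
    ∀ a ∈ U, ∀ r ∈ P, r.head = some a →
      (∃ l ∈ r.sBody, l.compl ∈ M) ∨ ∃ b ∈ r.bpos, b ∈ U

/-- The greatest unfounded set on `M` with respect to `P`. -/
def GUS (M : Set Lit) (P : Program) : Set Atom := ⋃₀ {U | unfoundedOn U M P}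

/-- The operator `W_P` of the well-founded semantics. -/
noncomputable def WOp (P : Program) (M : Set Lit) : Set Lit :=
  if consistentS M then
    M ∪ Lit.pos '' {a | ∃ r ∈ P, r.head = some a ∧ r.sBody ⊆ M} ∪ Lit.neg '' GUS M P
  else Lit.pos '' atomsProg P ∪ Lit.neg '' atomsProg P

/-- `W^i_P(M)`: the `i`-fold application of `W_P` to `M`. -/
noncomputable def WIter (P : Program) : ℕ → Set Lit → Set Lit
  | 0, M => M
  | n + 1, M => WOp P (WIter P n M)

/-- `W^fix_P(M)`: the least fixpoint of `W_P` above `M`. -/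
def WFix (P : Program) (M : Set Lit) : Set Lit := ⋂₀ {Y | M ⊆ Y ∧ WOp P Y ⊆ Y}

/-! ## PC(ID) -/

/-- A program is weakly normal if every head is an atom. -/
def weaklyNormal (P : Program) : Prop := ∀ r ∈ P, r.head ≠ none

/-- A program is normal if every head is an atom and no double negation occurs. -/
def normalProg (P : Program) : Prop := ∀ r ∈ P, r.head ≠ none ∧ r.bnneg = ∅

/-- `O^Π = At(F∪Π) \ Head(Π)`: the open atoms of the pair `(F,Π)`. -/
def openAtomsTh (F : CNF) (P : Program) : Set Atom := atomsTh F P \ headSet P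

/-- A model of the PC(ID) theory `(F,Π)`. -/
def pcidModel (F : CNF) (P : Program) (M : Set Lit) : Prop :=
  consistentS M ∧ completeOver M (atomsTh F P) ∧ modelCNF M F ∧
    M = WFix (progO F P) (restrictLits M (openAtomsTh F P))

/-- The PC(ID) theory `(F,Π)` is total: `W^fix_{Π^o}(M^{O^Π})` assigns all atoms of
`At(F∪Π)` for every model `M` of `F`. -/
def pcidTotal (F : CNF) (P : Program) : Prop :=
  ∀ M : Set Lit, consistentS M → completeOver M (atomsTh F P) → modelCNF M F →
    ∀ a ∈ atomsTh F P,
      Lit.pos a ∈ WFix (progO F P) (restrictLits M (openAtomsTh F P)) ∨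
      Lit.neg a ∈ WFix (progO F P) (restrictLits M (openAtomsTh F P))

/-! ## Clausal forms and completion -/

/-- The clause corresponding to a rule. -/
def ruleClause (r : Rule) : Clause :=
  (match r.head with | some a => ({Lit.pos a} : Set Lit) | none => (∅ : Set Lit)) ∪
    (Lit.neg '' r.bpos ∪ Lit.pos '' r.bneg ∪ Lit.neg '' r.bnneg)

/-- `Π^cl`: the clause forms of the rules of `Π`. -/
def progCl (P : Program) : CNF := ruleClause '' P

/-- `a` is a fact in `P`: some rule with head `a` has an empty body. -/
def isFactAtom (P : Program) (a : Atom) : Prop :=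
  ∃ r ∈ P, r.head = some a ∧ r.bodyAtoms = ∅

/-- `Comp(Π)`: the clausified completion of `Π`: the clauses `Π^cl` together with all
clauses obtained by distributivity from `¬a ∨ ⋁_{B ∈ Bodies(Π,a)} B`, for every
atom `a` of `Π` that is not a fact. -/
def compClauses (P : Program) : CNF :=
  progCl P ∪
    {C | ∃ a ∈ atomsProg P, ¬ isFactAtom P a ∧
      ∃ f : BodyT → Lit, (∀ B ∈ bodiesOf P a, f B ∈ sBodyB B) ∧
        C = insert (Lit.neg a) (f '' bodiesOf P a)}

/-- The number of program literals in a body. -/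
noncomputable def bodySize (B : BodyT) : ℕ := B.1.ncard + B.2.1.ncard + B.2.2.ncard

/-- `ν` provides the literals `f_B` used by `ED-Comp`: for a singleton body, the
literal `s(l)` of its unique element; for larger bodies, fresh pairwise distinct atoms. -/
def goodNaming (P : Program) (ν : BodyT → Lit) : Prop :=
  (∀ B : BodyT, bodySize B = 1 → ν B ∈ sBodyB B) ∧
  (∀ B : BodyT, 1 < bodySize B → (∃ a : Atom, ν B = Lit.pos a) ∧ (ν B).atom ∉ atomsProg P) ∧
  ∀ B B' : BodyT, 1 < bodySize B → 1 < bodySize B' → ν B = ν B' → B = B'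

/-- `ED-Comp(P)` with respect to the naming `ν`. -/
def EDComp (ν : BodyT → Lit) (P : Program) : CNF :=
  progCl P ∪
  {C | ∃ a ∈ atomsProg P, ¬ isFactAtom P a ∧ ¬ (bodiesOf P a).Subsingleton ∧
        C = insert (Lit.neg a) (ν '' bodiesOf P a)} ∪
  {C | ∃ a ∈ atomsProg P, ∃ B : BodyT, bodiesOf P a = {B} ∧ ∃ l ∈ sBodyB B, C = {Lit.neg a, l}} ∪
  {C | ∃ a ∈ atomsProg P, bodiesOf P a = ∅ ∧ C = {Lit.neg a}} ∪
  {C | ∃ a ∈ atomsProg P, ¬ isFactAtom P a ∧ ¬ (bodiesOf P a).Subsingleton ∧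
        ∃ B ∈ bodiesOf P a, 1 < bodySize B ∧
          ((∃ l ∈ sBodyB B, C = {(ν B).compl, l}) ∨ C = insert (ν B) (compls (sBodyB B)))}

/-! ## PC(ID) theories as programs with constraints -/

/-- `C^r`: the constraint corresponding to a clause `C`. -/
def clauseRule (C : Clause) : Rule := ⟨none, {a | Lit.neg a ∈ C}, {a | Lit.pos a ∈ C}, ∅⟩

/-- `F^r = {C^r : C ∈ F}`. -/
def constraintsOf (F : CNF) : Program := clauseRule '' F

/-- `π(F,Π) = Π^o ∪ F^r`. -/
def piProg (F : CNF) (P : Program) : Program := progO F P ∪ constraintsOf F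

/-! ## Program transformations `ch(N)` and `Π(N)` -/

/-- `ch(N)`: the rules `a ← not not a` for the atoms `a` occurring in `N`. -/
def chProg (N : Set Lit) : Program := choiceRule '' (Lit.atom '' N)

/-- The body of `r` contains a program literal `l` with `s(l)` complement in `N`. -/
def ruleKilled (r : Rule) (N : Set Lit) : Prop :=
  (∃ a ∈ r.bpos, Lit.neg a ∈ N) ∨ (∃ a ∈ r.bneg, Lit.pos a ∈ N) ∨ ∃ a ∈ r.bnneg, Lit.neg a ∈ N

/-- Delete from the body of `r` every program literal `l` with `s(l) ∈ N`. -/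
def ruleReduce (r : Rule) (N : Set Lit) : Rule :=
  ⟨r.head, {a ∈ r.bpos | Lit.pos a ∉ N}, {a ∈ r.bneg | Lit.neg a ∉ N},
    {a ∈ r.bnneg | Lit.pos a ∉ N}⟩

/-- `Π(N)`: remove the rules killed by `N` and reduce the bodies of the remaining rules. -/
def progReduce (P : Program) (N : Set Lit) : Program :=
  (fun r => ruleReduce r N) '' {r ∈ P | ¬ ruleKilled r N}

/-! ## DPLL states and transition graphs -/

/-- A possibly decision-annotated literal. -/
structure ALit where
  lit : Lit
  dec : Bool
deriving DecidableEq

/-- A state: `fail` or a record (ordered list of annotated literals). -/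
inductive DpState where
  | fail : DpState
  | of : List ALit → DpState

/-- The literals of a record, in order. -/
def litsOf (M : List ALit) : List Lit := M.map ALit.lit

/-- The set of literals of a record. -/
def litSet (M : List ALit) : Set Lit := {l | l ∈ litsOf M}

/-- A record is inconsistent if it contains an atom together with its negation. -/
def inconsistentRec (M : List ALit) : Prop :=
  ∃ a : Atom, Lit.pos a ∈ litsOf M ∧ Lit.neg a ∈ litsOf M

/-- A record contains no decision literals. -/
def noDecision (M : List ALit) : Prop := ∀ x ∈ M, x.dec = false

/-- `l` is unassigned by the record `M`. -/
def unassignedBy (M : List ALit) (l : Lit) : Prop := l ∉ litsOf M ∧ l.compl ∉ litsOf M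

/-- A record relative to the set `A` of atoms: an ordered set of literals over `A`. -/
def isRecord (A : Set Atom) (M : List ALit) : Prop :=
  (litsOf M).Nodup ∧ ∀ l ∈ litsOf M, l.atom ∈ A

/-- A state relative to the set `A` of atoms. -/
def isState (A : Set Atom) : DpState → Prop
  | .fail => True
  | .of M => isRecord A M

/-- The transition rules of the DPLL graph of the clause set `G`. -/
inductive DPStep (G : CNF) : DpState → DpState → Prop
  | unitPropagate (M : List ALit) (C : Clause) (l : Lit) :
      C ∈ G → l ∈ C → (∀ k ∈ C, k ≠ l → k.compl ∈ litsOf M) →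
      DPStep G (.of M) (.of (M ++ [⟨l, false⟩]))
  | decide (M : List ALit) (l : Lit) :
      unassignedBy M l → DPStep G (.of M) (.of (M ++ [⟨l, true⟩]))
  | fail (M : List ALit) :
      inconsistentRec M → noDecision M → DPStep G (.of M) .fail
  | backtrack (Pre Q : List ALit) (l : Lit) :
      inconsistentRec (Pre ++ ⟨l, true⟩ :: Q) → noDecision Q →
      DPStep G (.of (Pre ++ ⟨l, true⟩ :: Q)) (.of (Pre ++ [⟨l.compl, false⟩]))

/-- The edges of the graph `DP_G` over states relative to `A`. -/
def dpEdge (G : CNF) (A : Set Atom) (s s' : DpState) : Prop :=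
  isState A s ∧ isState A s' ∧ DPStep G s s'

/-- The transition rules of the graph `SM(ASP)_{F,Π}`: the DPLL rules for `F ∪ Π^cl`
together with the rule Unfounded (w.r.t. `Π^o`). -/
inductive SMStep (F : CNF) (P : Program) : DpState → DpState → Prop
  | dpll {s s' : DpState} : DPStep (F ∪ progCl P) s s' → SMStep F P s s'
  | unfounded (M : List ALit) (U : Set Atom) (a : Atom) :
      consistentS (litSet M) → unfoundedOn U (litSet M) (progO F P) → a ∈ U →
      SMStep F P (.of M) (.of (M ++ [⟨Lit.neg a, false⟩]))

/-- The edges of the graph `SM(ASP)_{F,Π}`. -/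
def smEdge (F : CNF) (P : Program) (s s' : DpState) : Prop :=
  isState (atomsTh F P) s ∧ isState (atomsTh F P) s' ∧ SMStep F P s s'

/-- `F,Π^o ⊨ C`: every model of the SM(ASP) theory `[F,Π]` satisfies the clause `C`. -/
def entailsClause (F : CNF) (P : Program) (C : Clause) : Prop :=
  ∀ M : Set Lit, smModel F P M → ∃ l ∈ C, l ∈ M

/-- Augmented states: `fail`, or a record together with a set of learned clauses. -/
inductive ANode where
  | fail : ANode
  | st : List ALit → CNF → ANode

/-- A valid augmented state relative to `F` and `Π`. -/
def isANode (F : CNF) (P : Program) : ANode → Prop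
  | .fail => True
  | .st M Γ => isRecord (atomsTh F P) M ∧
      ∀ C ∈ Γ, (∀ l ∈ C, l.atom ∈ atomsTh F P) ∧ entailsClause F P C

/-- The basic transition rules of the graph `SM(ASP)L_{F,Π}`. -/
inductive SMLBasic (F : CNF) (P : Program) : ANode → ANode → Prop
  | unitPropagateLearn (M : List ALit) (Γ : CNF) (C : Clause) (l : Lit) :
      C ∈ F ∪ progCl P ∪ Γ → l ∈ C → (∀ k ∈ C, k ≠ l → k.compl ∈ litsOf M) →
      SMLBasic F P (.st M Γ) (.st (M ++ [⟨l, false⟩]) Γ)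
  | decide (M : List ALit) (Γ : CNF) (l : Lit) :
      unassignedBy M l → SMLBasic F P (.st M Γ) (.st (M ++ [⟨l, true⟩]) Γ)
  | fail (M : List ALit) (Γ : CNF) :
      inconsistentRec M → noDecision M → SMLBasic F P (.st M Γ) .fail
  | backjump (Pre Q : List ALit) (l l' : Lit) (Γ : CNF) :
      inconsistentRec (Pre ++ ⟨l, true⟩ :: Q) →
      entailsClause F P (insert l' (compls (litSet Pre))) →
      SMLBasic F P (.st (Pre ++ ⟨l, true⟩ :: Q) Γ) (.st (Pre ++ [⟨l', false⟩]) Γ)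
  | unfounded (M : List ALit) (Γ : CNF) (U : Set Atom) (a : Atom) :
      consistentS (litSet M) → unfoundedOn U (litSet M) (progO F P) → a ∈ U →
      SMLBasic F P (.st M Γ) (.st (M ++ [⟨Lit.neg a, false⟩]) Γ)

/-- The transition rule Learn of `SM(ASP)L_{F,Π}`. -/
def learnStep (F : CNF) (P : Program) (n n' : ANode) : Prop :=
  ∃ (M : List ALit) (Γ : CNF) (C : Clause),
    n = ANode.st M Γ ∧ n' = ANode.st M (insert C Γ) ∧
    (∀ l ∈ C, l.atom ∈ atomsCNF F) ∧ entailsClause F P C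

/-- The transition rules of `SM(ASP)L_{F,Π}`: the basic rules and Learn. -/
def SMLStep (F : CNF) (P : Program) (n n' : ANode) : Prop :=
  SMLBasic F P n n' ∨ learnStep F P n n'

/-- The edges of the graph `SM(ASP)L_{F,Π}`. -/
def smlEdge (F : CNF) (P : Program) (n n' : ANode) : Prop :=
  isANode F P n ∧ isANode F P n' ∧ SMLStep F P n n'

/-- The edges of `SM(ASP)L_{F,Π}` justified by a basic transition rule. -/
def smlBasicEdge (F : CNF) (P : Program) (n n' : ANode) : Prop :=
  isANode F P n ∧ isANode F P n' ∧ SMLBasic F P n n'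

/-- `F` is a `Π`-safe set of clauses. -/
def piSafe (F : CNF) (P : Program) : Prop :=
  (∀ a ∈ atomsProg P \ headSet P, ∀ X : Set Atom, cnfTrue X F → a ∉ X) ∧
  ∀ X : Set Atom, isAnswerSet P X →
    ∃ M : Set Lit, consistentS M ∧ completeOver M (atomsTh F P) ∧ modelCNF M F ∧
      X = posPart M ∩ headSet P

/-! ## Auxiliary facts -/

theorem sBody_subset_iff {r : Rule} {M : Set Lit} :
    r.sBody ⊆ M ↔ (∀ a ∈ r.bpos, Lit.pos a ∈ M) ∧ (∀ a ∈ r.bneg, Lit.neg a ∈ M) ∧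
      ∀ a ∈ r.bnneg, Lit.pos a ∈ M := by
  simp only [Rule.sBody, Set.union_subset_iff, Set.image_subset_iff, and_assoc]
  rfl

theorem head_mem_atomsProg {P : Program} {r : Rule} {a : Atom} (hr : r ∈ P)
    (ha : r.head = some a) : a ∈ atomsProg P := by
  simp only [atomsProg, Set.mem_iUnion]
  exact ⟨r, hr, by simp [Rule.atoms, ha]⟩

theorem bodyAtoms_subset_atomsProg {P : Program} {r : Rule} (hr : r ∈ P) :
    r.bodyAtoms ⊆ atomsProg P := by
  intro a ha
  simp only [atomsProg, Set.mem_iUnion]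
  exact ⟨r, hr, Or.inr ha⟩

theorem consistentS.mono {M N : Set Lit} (h : M ⊆ N) (hN : consistentS N) : consistentS M :=
  fun a ha => hN a ⟨h ha.1, h ha.2⟩

theorem consistentS.compl_notMem {M : Set Lit} (h : consistentS M) {l : Lit} (hl : l ∈ M) :
    l.compl ∉ M := by
  cases l with
  | pos a => exact fun hc => h a ⟨hl, hc⟩
  | neg a => exact fun hc => h a ⟨hc, hl⟩

theorem GUS_mono {M N : Set Lit} (h : M ⊆ N) (P : Program) : GUS M P ⊆ GUS N P := by
  rintro a ⟨U, ⟨hU, hU'⟩, ha⟩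
  refine ⟨U, ⟨hU, fun b hb r hr hrb => ?_⟩, ha⟩
  exact (hU' b hb r hr hrb).imp_left fun ⟨l, hl, hlM⟩ => ⟨l, hl, h hlM⟩

theorem GUS_subset_atomsProg (M : Set Lit) (P : Program) : GUS M P ⊆ atomsProg P := by
  rintro a ⟨U, hU, ha⟩
  exact hU.1 ha

/-- The operator `W_P` is monotone up to its argument. -/
theorem WOp_subset_union {M N : Set Lit} (h : M ⊆ N) (hM : consistentS M) (P : Program) :
    WOp P M ⊆ N ∪ WOp P N := by
  intro l hl
  rw [WOp, if_pos hM] at hl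
  by_cases hN : consistentS N
  · refine Or.inr ?_
    rw [WOp, if_pos hN]
    rcases hl with (hl | ⟨a, ⟨r, hr, hra, hrb⟩, rfl⟩) | ⟨a, ha, rfl⟩
    · exact Or.inl (Or.inl (h hl))
    · exact Or.inl (Or.inr ⟨a, ⟨r, hr, hra, hrb.trans h⟩, rfl⟩)
    · exact Or.inr ⟨a, GUS_mono h P ha, rfl⟩
  · rw [WOp, if_neg hN]
    rcases hl with (hl | ⟨a, ⟨r, hr, hra, -⟩, rfl⟩) | ⟨a, ha, rfl⟩
    · exact Or.inl (h hl)
    · exact Or.inr (Or.inl ⟨a, head_mem_atomsProg hr hra, rfl⟩)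
    · exact Or.inr (Or.inr ⟨a, GUS_subset_atomsProg M P ha, rfl⟩)

/-- A consistent `W^fix_P(M)` is closed under `W_P`. -/
theorem WOp_WFix_subset {P : Program} {M : Set Lit} (h : consistentS (WFix P M)) :
    WOp P (WFix P M) ⊆ WFix P M := by
  rintro l hl Y ⟨hMY, hY⟩
  have hsub : WFix P M ⊆ Y := Set.sInter_subset_of_mem ⟨hMY, hY⟩
  exact (WOp_subset_union hsub h P hl).elim id fun hl => hY hl

theorem mem_progExt_cases {P : Program} {A : Set Atom} {r : Rule} (hr : r ∈ progExt P A) :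
    r ∈ P ∨ ∃ a ∈ A, a ∉ headSet P ∧ r = choiceRule a := by
  rcases hr with hr | ⟨a, ⟨ha, ha'⟩, rfl⟩
  · exact Or.inl hr
  · exact Or.inr ⟨a, ha, ha', rfl⟩

theorem atomsProg_progExt_subset (P : Program) (A : Set Atom) :
    atomsProg (progExt P A) ⊆ atomsProg P ∪ A := by
  intro a ha
  simp only [atomsProg, Set.mem_iUnion] at ha
  obtain ⟨r, hr, ha⟩ := ha
  rcases mem_progExt_cases hr with hr | ⟨b, hb, -, rfl⟩
  · refine Or.inl ?_
    simp only [atomsProg, Set.mem_iUnion]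
    exact ⟨r, hr, ha⟩
  · have : a = b := by simpa [Rule.atoms, Rule.bodyAtoms, choiceRule] using ha
    exact Or.inr (this ▸ hb)

theorem reductKeeps_of_sBody_subset {r : Rule} {M : Set Lit} (hM : consistentS M)
    (h : r.sBody ⊆ M) : reductKeeps r (posPart M) := by
  rw [sBody_subset_iff] at h
  exact ⟨fun a ha hp => hM a ⟨hp, h.2.1 a ha⟩, h.2.2⟩

theorem neg_mem_of_notMem_posPart {M : Set Lit} {A : Set Atom} (hM : completeOver M A)
    {a : Atom} (ha : a ∈ A) (h : a ∉ posPart M) : Lit.neg a ∈ M :=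
  (hM.1 a ha).resolve_left h

theorem sBody_subset_of_reductKeeps {r : Rule} {M : Set Lit} {A : Set Atom}
    (hM : completeOver M A) (hA : r.bodyAtoms ⊆ A) (hk : reductKeeps r (posPart M))
    (hp : r.bpos ⊆ posPart M) : r.sBody ⊆ M := by
  rw [sBody_subset_iff]
  exact ⟨fun a ha => hp ha, fun a ha =>
    neg_mem_of_notMem_posPart hM (hA (Or.inl (Or.inr ha))) (hk.1 a ha), hk.2⟩

/-- An input answer set of a weakly normal program is the least set containing its open
atoms and closed under the reduct. -/
theorem inputAnswerSet_iff {P : Program} (hP : weaklyNormal P) {X : Set Atom} :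
    inputAnswerSet P X ↔ closedUnder P X X ∧
      ∀ Y, closedUnder P X Y → X \ headSet P ⊆ Y → X ⊆ Y := by
  have hcl : ∀ Y, closedUnder (P ∪ factRule '' (X \ headSet P)) X Y ↔
      closedUnder P X Y ∧ X \ headSet P ⊆ Y := by
    refine fun Y => ⟨fun h => ⟨fun r hr => h r (Or.inl hr), fun a ha => ?_⟩, ?_⟩
    · exact h (factRule a) (Or.inr ⟨a, ha, rfl⟩) (by simp [reductKeeps, factRule])
        (by simp [factRule]) a rfl
    · rintro ⟨h, h'⟩ r (hr | ⟨b, hb, rfl⟩) hk hp a ha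
      · exact h r hr hk hp a ha
      · cases ha
        exact h' hb
  constructor
  · rintro ⟨h, -⟩
    have hle : ∀ Y, closedUnder P X Y → X \ headSet P ⊆ Y → X ⊆ Y := fun Y h₁ h₂ => by
      rw [h]
      exact Set.sInter_subset_of_mem ((hcl Y).2 ⟨h₁, h₂⟩)
    refine ⟨fun r hr hk hp a ha => ?_, hle⟩
    rw [h]
    intro Y hY
    exact ((hcl Y).1 hY).1 r hr hk (hp.trans (hle Y ((hcl Y).1 hY).1 ((hcl Y).1 hY).2)) a ha
  · rintro ⟨h₁, h₂⟩
    refine ⟨Set.Subset.antisymm (Set.subset_sInter fun Y hY => ?_)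
      (Set.sInter_subset_of_mem ((hcl X).2 ⟨h₁, Set.sdiff_subset⟩)), ?_⟩
    · exact h₂ Y ((hcl Y).1 hY).1 ((hcl Y).1 hY).2
    · rintro r (hr | ⟨b, hb, rfl⟩) hn
      · exact absurd hn (hP r hr)
      · cases hn

/-- Atoms of an input answer set that are heads are supported. -/
theorem exists_supporting_rule {P : Program} (hP : weaklyNormal P) {X : Set Atom}
    (hX : inputAnswerSet P X) {a : Atom} (ha : a ∈ X) (hh : a ∈ headSet P) :
    ∃ r ∈ P, r.head = some a ∧ reductKeeps r X ∧ r.bpos ⊆ X := by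
  rw [inputAnswerSet_iff hP] at hX
  by_contra hcon
  push Not at hcon
  have hsub : X ⊆ X \ {a} := by
    refine hX.2 _ (fun r hr hk hp b hb => ⟨?_, ?_⟩) fun b hb => ⟨hb.1, ?_⟩
    · exact hX.1 r hr hk (hp.trans Set.sdiff_subset) b hb
    · rintro rfl
      exact hcon r hr hb hk (hp.trans Set.sdiff_subset)
    · rintro rfl
      exact hb.2 hh
  exact (hsub ha).2 rfl

theorem pcidModel.inputAnswerSet {F : CNF} {P : Program} (hP : weaklyNormal P) {M : Set Lit}
    (h : pcidModel F P M) : inputAnswerSet P (posPart M) := by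
  obtain ⟨hcon, hcomp, -, hfix⟩ := h
  have hclosed : WOp (progO F P) M ⊆ M := by
    have := WOp_WFix_subset (hfix ▸ hcon)
    rwa [← hfix] at this
  have hderive : ∀ r ∈ progO F P, ∀ a, r.head = some a → r.sBody ⊆ M → Lit.pos a ∈ M := by
    intro r hr a ha hb
    apply hclosed
    rw [WOp, if_pos hcon]
    exact Or.inl (Or.inr ⟨a, ⟨r, hr, ha, hb⟩, rfl⟩)
  rw [inputAnswerSet_iff hP]
  refine ⟨fun r hr hk hp a ha => ?_, fun Y hY hopen => ?_⟩
  · exact hderive r (Or.inl hr) a ha <| sBody_subset_of_reductKeeps hcomp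
      ((bodyAtoms_subset_atomsProg hr).trans Set.subset_union_right) hk hp
  · set Z : Set Lit := {l ∈ M | ∀ a, l = Lit.pos a → a ∈ Y}
    have hZM : Z ⊆ M := fun l hl => hl.1
    have hZcon : consistentS Z := hcon.mono hZM
    have hMZ : M ⊆ Z := by
      conv_lhs => rw [hfix]
      refine Set.sInter_subset_of_mem ⟨?_, ?_⟩
      · rintro l ⟨hl, hlo⟩
        refine ⟨hl, ?_⟩
        rintro a rfl
        exact hopen ⟨hl, hlo.2⟩
      · rw [WOp, if_pos hZcon]
        rintro l ((hl | ⟨a, ⟨r, hr, hra, hrb⟩, rfl⟩) | ⟨a, ha, rfl⟩)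
        · exact hl
        · refine ⟨hderive r hr a hra (hrb.trans hZM), ?_⟩
          rintro _ ⟨⟩
          have hb := sBody_subset_iff.1 hrb
          rcases mem_progExt_cases hr with hr | ⟨b, -, -, rfl⟩
          · exact hY r hr (reductKeeps_of_sBody_subset hcon (hrb.trans hZM))
              (fun b hbp => (hb.1 b hbp).2 b rfl) a hra
          · cases hra
            exact (hb.2.2 a rfl).2 a rfl
        · refine ⟨hclosed ?_, fun _ h => by cases h⟩
          rw [WOp, if_pos hcon]
          exact Or.inr ⟨a, GUS_mono hZM _ ha, rfl⟩
    exact fun a ha => (hMZ ha).2 a rfl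

theorem smModel.WOp_subset {F : CNF} {P : Program} (hP : weaklyNormal P) {M : Set Lit}
    (h : smModel F P M) : WOp (progO F P) M ⊆ M := by
  obtain ⟨hcon, hcomp, -, hX⟩ := h
  rw [inputAnswerSet_iff hP] at hX
  have hatoms : atomsProg (progO F P) ⊆ atomsTh F P :=
    (atomsProg_progExt_subset _ _).trans
      (Set.union_subset Set.subset_union_right subset_rfl)
  rw [WOp, if_pos hcon]
  rintro l ((hl | ⟨a, ⟨r, hr, hra, hrb⟩, rfl⟩) | ⟨a, ⟨U, hU, ha⟩, rfl⟩)
  · exact hl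
  · have hb := sBody_subset_iff.1 hrb
    rcases mem_progExt_cases hr with hr | ⟨b, -, -, rfl⟩
    · exact hX.1 r hr (reductKeeps_of_sBody_subset hcon hrb) hb.1 a hra
    · cases hra
      exact hb.2.2 a rfl
  · refine neg_mem_of_notMem_posPart hcomp (hatoms (hU.1 ha)) fun haX => ?_
    have hsub : posPart M ⊆ posPart M \ U := by
      refine hX.2 _ (fun r hr hk hp b hb => ?_) fun b hb => ⟨hb.1, fun hbU => ?_⟩
      · have hpX := hp.trans Set.sdiff_subset
        refine ⟨hX.1 r hr hk hpX b hb, fun hbU => ?_⟩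
        rcases hU.2 b hbU r (Or.inl hr) hb with ⟨l, hl, hlM⟩ | ⟨c, hc, hcU⟩
        · exact hcon.compl_notMem (sBody_subset_of_reductKeeps hcomp
            ((bodyAtoms_subset_atomsProg hr).trans Set.subset_union_right) hk hpX hl) hlM
        · exact (hp hc).2 hcU
      · rcases hU.2 b hbU (choiceRule b)
          (Or.inr ⟨b, ⟨hcomp.2 _ hb.1, hb.2⟩, rfl⟩) rfl with ⟨l, hl, hlM⟩ | ⟨c, hc, -⟩
        · have hl' : l = Lit.pos b := by simpa [Rule.sBody, choiceRule] using hl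
          subst hl'
          exact hcon b ⟨hb.1, hlM⟩
        · exact hc
    exact (hsub haX).2 ha

theorem pcidModel_iff_smModel {F : CNF} {P : Program} (hP : weaklyNormal P)
    (htot : pcidTotal F P) {M : Set Lit} : pcidModel F P M ↔ smModel F P M := by
  refine ⟨fun h => ⟨h.1, h.2.1, h.2.2.1, h.inputAnswerSet hP⟩, fun h => ?_⟩
  obtain ⟨hcon, hcomp, hF, -⟩ := id h
  have hsub : WFix (progO F P) (restrictLits M (openAtomsTh F P)) ⊆ M :=
    Set.sInter_subset_of_mem ⟨fun l hl => hl.1, h.WOp_subset hP⟩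
  refine ⟨hcon, hcomp, hF, Set.Subset.antisymm (fun l hl => ?_) hsub⟩
  have hl' := htot M hcon hcomp hF l.atom (hcomp.2 l hl)
  cases l with
  | pos a => exact hl'.resolve_right fun hn => hcon a ⟨hl, hsub hn⟩
  | neg a => exact hl'.resolve_left fun hp => hcon a ⟨hsub hp, hl⟩

theorem atomsProg_progExt_self (P : Program) :
    atomsProg (progExt P (atomsProg P)) = atomsProg P := by
  refine Set.Subset.antisymm ?_ (Set.biUnion_subset_biUnion_left Set.subset_union_left)
  exact (atomsProg_progExt_subset _ _).trans (Set.union_self _).subset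

theorem atom_mem_of_mem_sBody {P : Program} {r : Rule} (hr : r ∈ P) {l : Lit}
    (hl : l ∈ r.sBody) : l.atom ∈ atomsProg P := by
  apply bodyAtoms_subset_atomsProg hr
  rcases hl with (⟨a, ha, rfl⟩ | ⟨a, ha, rfl⟩) | ⟨a, ha, rfl⟩
  · exact Or.inl (Or.inl ha)
  · exact Or.inl (Or.inr ha)
  · exact Or.inr ha

theorem atomsCNF_compClauses_subset (P : Program) : atomsCNF (compClauses P) ⊆ atomsProg P := by
  intro a ha
  simp only [atomsCNF, Set.mem_iUnion] at ha
  obtain ⟨C, hC, l, hl, rfl⟩ := ha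
  rcases hC with ⟨r, hr, rfl⟩ | ⟨a, ha, -, f, hf, rfl⟩
  · rcases hl with hl | (⟨a, ha, rfl⟩ | ⟨a, ha, rfl⟩) | ⟨a, ha, rfl⟩
    · rcases hh : r.head with _ | b
      · simp [hh] at hl
      · simp only [hh, Set.mem_singleton_iff] at hl
        subst hl
        exact head_mem_atomsProg hr hh
    · exact bodyAtoms_subset_atomsProg hr (Or.inl (Or.inl ha))
    · exact bodyAtoms_subset_atomsProg hr (Or.inl (Or.inr ha))
    · exact bodyAtoms_subset_atomsProg hr (Or.inr ha)
  · rcases hl with rfl | ⟨B, hB, rfl⟩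
    · exact ha
    · have hfB := hf B hB
      obtain ⟨r, hr, -, rfl⟩ := hB
      exact atom_mem_of_mem_sBody hr hfB

theorem atomsTh_compClauses_union (F : CNF) (P : Program) :
    atomsTh (compClauses (progExt P (atomsProg P)) ∪ F) P = atomsTh F P := by
  have h := atomsCNF_compClauses_subset (progExt P (atomsProg P))
  rw [atomsProg_progExt_self] at h
  have hU : atomsCNF (compClauses (progExt P (atomsProg P)) ∪ F) =
      atomsCNF (compClauses (progExt P (atomsProg P))) ∪ atomsCNF F := Set.biUnion_union _ _ _
  rw [atomsTh, atomsTh, hU]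
  ext a
  have := @h a
  simp only [Set.mem_union]
  tauto

/-- An input answer set satisfies the completion of `Π_{At(Π)}`. -/
theorem smModel.modelCNF_compClauses {F : CNF} {P : Program} (hP : weaklyNormal P) {M : Set Lit}
    (h : smModel F P M) : modelCNF M (compClauses (progExt P (atomsProg P))) := by
  obtain ⟨-, hcomp, -, hX⟩ := h
  have hX' := (inputAnswerSet_iff hP).1 hX
  rintro C (⟨r, hr, rfl⟩ | ⟨a, ha, -, f, hf, rfl⟩)
  · rcases mem_progExt_cases hr with hr | ⟨b, hb, -, rfl⟩
    · have hat : r.bodyAtoms ⊆ atomsTh F P :=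
        (bodyAtoms_subset_atomsProg hr).trans Set.subset_union_right
      by_contra hno
      push Not at hno
      have hp : r.bpos ⊆ posPart M := fun b hb => by
        by_contra hbX
        exact hno _ (Or.inr (Or.inl (Or.inl ⟨b, hb, rfl⟩)))
          (neg_mem_of_notMem_posPart hcomp (hat (Or.inl (Or.inl hb))) hbX)
      have hk : reductKeeps r (posPart M) := by
        refine ⟨fun b hb => hno _ (Or.inr (Or.inl (Or.inr ⟨b, hb, rfl⟩))), fun b hb => ?_⟩
        by_contra hbX
        exact hno _ (Or.inr (Or.inr ⟨b, hb, rfl⟩))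
          (neg_mem_of_notMem_posPart hcomp (hat (Or.inr hb)) hbX)
      obtain ⟨b, hb⟩ := Option.ne_none_iff_exists'.1 (hP r hr)
      exact hno (Lit.pos b) (Or.inl (by simp [hb])) (hX'.1 r hr hk hp b hb)
    · rcases hcomp.1 b (Or.inr hb) with hbM | hbM
      · exact ⟨Lit.pos b, by simp [ruleClause, choiceRule], hbM⟩
      · exact ⟨Lit.neg b, by simp [ruleClause, choiceRule], hbM⟩
  · rw [atomsProg_progExt_self] at ha
    by_cases haX : a ∈ posPart M
    · obtain ⟨r, hr, hra, hrb⟩ : ∃ r ∈ progExt P (atomsProg P),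
          r.head = some a ∧ r.sBody ⊆ M := by
        by_cases hh : a ∈ headSet P
        · obtain ⟨r, hr, hra, hk, hp⟩ := exists_supporting_rule hP hX haX hh
          exact ⟨r, Or.inl hr, hra, sBody_subset_of_reductKeeps hcomp
            ((bodyAtoms_subset_atomsProg hr).trans Set.subset_union_right) hk hp⟩
        · refine ⟨choiceRule a, Or.inr ⟨a, ⟨ha, hh⟩, rfl⟩, rfl, ?_⟩
          rw [sBody_subset_iff]
          refine ⟨fun b hb => hb.elim, fun b hb => hb.elim, ?_⟩
          rintro b rfl
          exact haX
      have hB : r.body ∈ bodiesOf (progExt P (atomsProg P)) a := ⟨r, hr, hra, rfl⟩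
      exact ⟨f r.body, Or.inr ⟨_, hB, rfl⟩, hrb (hf _ hB)⟩
    · exact ⟨Lit.neg a, Or.inl rfl, neg_mem_of_notMem_posPart hcomp (Or.inr ha) haX⟩

theorem smModel_compClauses_iff {F : CNF} {P : Program} (hP : weaklyNormal P) {M : Set Lit} :
    smModel (compClauses (progExt P (atomsProg P)) ∪ F) P M ↔ smModel F P M := by
  constructor
  · rintro ⟨hcon, hcomp, hF, hX⟩
    rw [atomsTh_compClauses_union] at hcomp
    exact ⟨hcon, hcomp, fun C hC => hF C (Or.inr hC), hX⟩
  · intro h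
    refine ⟨h.1, ?_, ?_, h.2.2.2⟩
    · rw [atomsTh_compClauses_union]
      exact h.2.1
    · rintro C (hC | hC)
      · exact h.modelCNF_compClauses hP C hC
      · exact h.2.2.1 C hC

/-- For a total PC(ID) theory `(F,Π)` and a set `M` of literals over
`At(F∪Π)`, the following are equivalent: (a) `M` is a model of `(F,Π)`; (b) `M` is a model
of the SM(ASP) theory `[F,Π]`; (c) `M` is a model of the SM(ASP) theory
`[Comp(Π_{At(Π)}) ∪ F, Π]`. -/
theorem pcid_model_smasp_characterizations (F : CNF) (P : Program)
    (hF : IsCNF F) (hP : IsProgram P) (hwn : weaklyNormal P) (htot : pcidTotal F P)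
    (M : Set Lit) (hM : ∀ l ∈ M, l.atom ∈ atomsTh F P) :
    (pcidModel F P M ↔ smModel F P M) ∧
    (pcidModel F P M ↔ smModel (compClauses (progExt P (atomsProg P)) ∪ F) P M) :=
  ⟨pcidModel_iff_smModel hwn htot,
    (pcidModel_iff_smModel hwn htot).trans (smModel_compClauses_iff hwn).symm⟩
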